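/- Let L : ℝⁿ → ℝⁿ be an invertible linear map, A ⊆ ℝⁿ a measurable set, and B := L(A). Let g, g' be measurable families assigning to each point of ℝⁿ a symmetric positive-definite bilinear form on ℝⁿ, and suppose the Landsberg-type compatibility g'(L y)(Lξ, Lη) = g(y)(ξ, η) holds for all y ∈ A and all ξ, η ∈ ℝⁿ. Assume y ↦ g(y)(ξ,η)·√(det g(y)) is integrable on A for all ξ, η. Define the averaged forms 𝐆(ξ, η) := ∫_A g(y)(ξ, η) √(det g(y)) dy and 𝐆'(ξ, η) := ∫_B g'(z)(ξ, η) √(det g'(z)) dz, where det denotes the determinant of the Gram matrix of the form in the standard basis and dy, dz denote Lebesgue measure. Then 𝐆(ξ, η) = 𝐆'(Lξ, Lη) for all ξ, η ∈ ℝⁿ. -/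

import Mathlib

open Matrix MeasureTheory

/-- Szabó's key claim, valid when the parallel transport is a LINEAR map `L`: if the
measurable families `g, g'` of symmetric positive-definite bilinear forms (modeled by
their Gram matrices in the standard basis) satisfy the Landsberg-type compatibility
`g' (L y) (L ξ, L η) = g y (ξ, η)` for all `y ∈ A`, then the averaged forms
`𝐆(ξ,η) = ∫_A g y (ξ,η) √(det g y) dy` and `𝐆'(ξ,η) = ∫_B g' z (ξ,η) √(det g' z) dz`
(with `B = L(A)` and `dy, dz` Lebesgue measure) satisfy `𝐆(ξ,η) = 𝐆'(Lξ, Lη)`. -/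
theorem averaged_metric_preserved_linear_transport (n : ℕ)
    (L : Matrix (Fin n) (Fin n) ℝ) (hL : IsUnit L.det)
    (A : Set (Fin n → ℝ)) (hA : MeasurableSet A)
    (B : Set (Fin n → ℝ)) (hB : B = L.mulVec '' A)
    (g g' : (Fin n → ℝ) → Matrix (Fin n) (Fin n) ℝ)
    (hgmeas : ∀ i j, Measurable fun y => g y i j)
    (hg'meas : ∀ i j, Measurable fun z => g' z i j)
    (hgpos : ∀ y, (g y).PosDef) (hg'pos : ∀ z, (g' z).PosDef)
    (hcompat : ∀ y ∈ A, ∀ ξ η : Fin n → ℝ,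
      L.mulVec ξ ⬝ᵥ (g' (L.mulVec y)).mulVec (L.mulVec η) = ξ ⬝ᵥ (g y).mulVec η)
    (hint : ∀ ξ η : Fin n → ℝ,
      IntegrableOn (fun y => (ξ ⬝ᵥ (g y).mulVec η) * Real.sqrt (g y).det) A volume) :
    ∀ ξ η : Fin n → ℝ,
      ∫ y in A, (ξ ⬝ᵥ (g y).mulVec η) * Real.sqrt (g y).det =
        ∫ z in B, (L.mulVec ξ ⬝ᵥ (g' z).mulVec (L.mulVec η)) * Real.sqrt (g' z).det := by
  intro ξ η
  subst hB
  set T : (Fin n → ℝ) →L[ℝ] (Fin n → ℝ) := LinearMap.toContinuousLinearMap (Matrix.toLin' L)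
    with hT
  have hTdet : T.det = L.det := by
    rw [hT, ContinuousLinearMap.det, LinearMap.coe_toContinuousLinearMap, LinearMap.det_toLin']
  have hTapp : ∀ x, T x = L.mulVec x := fun x => by simp [hT]
  have hfun : (L.mulVec : (Fin n → ℝ) → (Fin n → ℝ)) = T := by
    funext x
    exact (hTapp x).symm
  have hinj : Function.Injective (L.mulVec : (Fin n → ℝ) → (Fin n → ℝ)) :=
    Matrix.mulVec_injective_of_isUnit ((Matrix.isUnit_iff_isUnit_det L).2 hL)
  have hder : ∀ x ∈ A, HasFDerivWithinAt L.mulVec T A x := by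
    intro x _
    rw [hfun]
    exact T.hasFDerivWithinAt
  rw [integral_image_eq_integral_abs_det_fderiv_smul volume hA hder hinj.injOn]
  refine setIntegral_congr_fun hA fun y hy => ?_
  have hmat : g y = Lᵀ * g' (L.mulVec y) * L := by
    ext i j
    have h := hcompat y hy (Pi.single i 1) (Pi.single j 1)
    have h2 : L.mulVec (Pi.single i 1) ⬝ᵥ
        (g' (L.mulVec y)).mulVec (L.mulVec (Pi.single j 1)) =
        Pi.single i 1 ⬝ᵥ (Lᵀ * g' (L.mulVec y) * L).mulVec (Pi.single j 1) := by
      rw [← Matrix.mulVec_mulVec, ← Matrix.mulVec_mulVec, Matrix.dotProduct_mulVec _ Lᵀ,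
        Matrix.vecMul_transpose]
    rw [h2] at h
    simpa using h.symm
  have hdet : Real.sqrt (g y).det = |L.det| * Real.sqrt (g' (L.mulVec y)).det := by
    rw [hmat, Matrix.det_mul, Matrix.det_mul, Matrix.det_transpose,
      show L.det * (g' (L.mulVec y)).det * L.det = L.det ^ 2 * (g' (L.mulVec y)).det by ring,
      Real.sqrt_mul (sq_nonneg _), Real.sqrt_sq_eq_abs]
  simp only [smul_eq_mul]
  rw [hcompat y hy, hdet, hTdet]
  ring
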